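/- arXiv:2110.02155 — 3 statements merged into one kernel-verified Lean document; each statement's English description precedes it below -/
import Mathlib

section
/- Let r ∈ ℝ with 0 < r < 1, let k₁, …, k_ℓ ∈ ℕ with ℓ ≥ 1, and let K ∈ ℕ with K ≥ k₁ + ⋯ + k_ℓ. Then for every tuple (n₁, …, n_ℓ) of natural numbers with (k₁+n₁) + ⋯ + (k_ℓ+n_ℓ) = K, the conditioning of the parallel negative binomials on the event that the coordinates sum to K yields the Pólya probability: (∏_{i=1}^{ℓ} MC(kᵢ, nᵢ) · r^{kᵢ} · (1−r)^{nᵢ}) / (∑_{(m₁,…,m_ℓ) : ∑ᵢ (kᵢ+mᵢ) = K} ∏_{i=1}^{ℓ} MC(kᵢ, mᵢ) · r^{kᵢ} · (1−r)^{mᵢ}) = (∏_{i=1}^{ℓ} MC(kᵢ, nᵢ)) / MC(k₁+⋯+k_ℓ, K − (k₁+⋯+k_ℓ)). -/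
/-- The multichoose coefficient `MC n m = C(n+m-1, m)`. -/
def MC (a b : ℕ) : ℕ := (a + b - 1).choose b

theorem MC_eq_multichoose (a b : ℕ) : MC a b = Nat.multichoose a b := by
  rw [Nat.multichoose_eq]; rfl

noncomputable def mcSeries (a : ℕ) : PowerSeries ℝ :=
  PowerSeries.mk fun n => (Nat.multichoose a n : ℝ)

theorem mcSeries_eq (a : ℕ) :
    mcSeries a = (PowerSeries.mk (1 : ℕ → ℝ)) ^ a := by
  induction a with
  | zero =>
    ext n
    cases n <;> simp [mcSeries, PowerSeries.coeff_one]
  | succ a ih =>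
    have h : mcSeries (a + 1) * (1 - PowerSeries.X) = mcSeries a := by
      rw [mul_sub, mul_one]
      ext n
      cases n with
      | zero => simp [mcSeries]
      | succ n => simp [mcSeries, PowerSeries.coeff_succ_mul_X, Nat.multichoose_succ_succ]
    have h1 := PowerSeries.mk_one_mul_one_sub_eq_one ℝ
    rw [pow_succ, ← ih, ← h, mul_assoc, mul_comm (1 - PowerSeries.X), h1, mul_one]

theorem mc_vandermonde {ℓ : ℕ} (k : Fin ℓ → ℕ) (N K : ℕ) (hK : ∑ i, k i + N = K) :
    ∑ m ∈ (Fintype.piFinset fun _ : Fin ℓ => Finset.range (K + 1)).filter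
          (fun m => ∑ i, (k i + m i) = K), ∏ i, (MC (k i) (m i) : ℝ)
      = (MC (∑ i, k i) N : ℝ) := by
  have h : ∏ i, mcSeries (k i) = mcSeries (∑ i, k i) := by
    simp only [mcSeries_eq, Finset.prod_pow_eq_pow_sum]
  have h2 := congrArg (PowerSeries.coeff N) h
  rw [PowerSeries.coeff_prod] at h2
  simp only [mcSeries, PowerSeries.coeff_mk, ← MC_eq_multichoose] at h2
  rw [← h2]
  symm
  refine Finset.sum_bij (fun l _ => (l : Fin ℓ → ℕ)) ?_ ?_ ?_ ?_
  · intro l hl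
    simp only [Finset.mem_finsuppAntidiag] at hl
    have hs : ∑ i, l i = N := hl.1
    simp only [Finset.mem_filter, Fintype.mem_piFinset, Finset.mem_range,
      Finset.sum_add_distrib]
    refine ⟨fun i => ?_, by omega⟩
    have : l i ≤ ∑ i, l i := Finset.single_le_sum (f := fun i => l i) (fun _ _ => Nat.zero_le _)
      (Finset.mem_univ i)
    omega
  · intro a _ b _ hab
    exact DFunLike.coe_injective hab
  · intro m hm
    simp only [Finset.mem_filter, Finset.sum_add_distrib] at hm
    refine ⟨Finsupp.equivFunOnFinite.symm m, ?_, rfl⟩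
    simp only [Finset.mem_finsuppAntidiag]
    refine ⟨?_, Finset.subset_univ _⟩
    have := hm.2
    change ∑ i, m i = N
    omega
  · intro l _
    rfl

/-- conditioning parallel negative binomials on the sum of
coordinates yields the Pólya distribution. -/
theorem negBinomial_conditioned_eq_polya
    (ℓ : ℕ) (hℓ : 1 ≤ ℓ) (r : ℝ) (hr0 : 0 < r) (hr1 : r < 1)
    (k : Fin ℓ → ℕ) (K : ℕ) (hK : ∑ i, k i ≤ K)
    (n : Fin ℓ → ℕ) (hsum : ∑ i, (k i + n i) = K) :
    (∏ i, (MC (k i) (n i) : ℝ) * r ^ k i * (1 - r) ^ n i) /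
      (∑ m ∈ (Fintype.piFinset fun _ : Fin ℓ => Finset.range (K + 1)).filter
          (fun m => ∑ i, (k i + m i) = K),
        ∏ i, (MC (k i) (m i) : ℝ) * r ^ k i * (1 - r) ^ m i)
      = (∏ i, (MC (k i) (n i) : ℝ)) / (MC (∑ i, k i) (K - ∑ i, k i) : ℝ) := by
  have key : ∀ m : Fin ℓ → ℕ, ∑ i, (k i + m i) = K →
      ∏ i, (MC (k i) (m i) : ℝ) * r ^ k i * (1 - r) ^ m i
        = (∏ i, (MC (k i) (m i) : ℝ)) *
          (r ^ (∑ i, k i) * (1 - r) ^ (K - ∑ i, k i)) := by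
    intro m hm
    rw [Finset.sum_add_distrib] at hm
    have : K - ∑ i, k i = ∑ i, m i := by omega
    rw [this, Finset.prod_mul_distrib, Finset.prod_mul_distrib,
      Finset.prod_pow_eq_pow_sum, Finset.prod_pow_eq_pow_sum, mul_assoc]
  rw [key n hsum, Finset.sum_congr rfl (fun m hm => key m (Finset.mem_filter.mp hm).2),
    ← Finset.sum_mul, mc_vandermonde k (K - ∑ i, k i) K (by omega)]
  have h1 : 0 < 1 - r := by linarith
  exact mul_div_mul_right _ _ (by positivity)
end

section
/- Let n, m, N, M be natural numbers with n ≥ 1, m ≥ 1, N ≥ 1, M ≥ 1. Then, as real numbers, n · MC(N,n) · ∑_{j=0}^{m−1} MC(M,j) / MC(n+j, N+M) + m · MC(M,m) · ∑_{i=0}^{n−1} MC(N,i) / MC(i+m, N+M) = N + M, where MC(a,b) = C(a+b−1, b) and C denotes the binomial coefficient. -/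
lemma MC_pos_aux (k T : ℕ) (hk : 1 ≤ k) : (0 : ℝ) < (MC k T : ℝ) := by
  unfold MC
  exact_mod_cast Nat.choose_pos (by omega)

lemma MC_step (N n : ℕ) (hN : 1 ≤ N) :
    ((n : ℝ) + 1) * (MC N (n + 1) : ℝ) = ((N : ℝ) + n) * (MC N n : ℝ) := by
  obtain ⟨a, rfl⟩ : ∃ a, N = a + 1 := ⟨N - 1, by omega⟩
  unfold MC
  have e1 : a + 1 + (n + 1) - 1 = a + n + 1 := by omega
  have e2 : a + 1 + n - 1 = a + n := by omega
  rw [e1, e2]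
  have h := Nat.add_one_mul_choose_eq (a + n) n
  have h' : ((a : ℝ) + n + 1) * ((a + n).choose n : ℝ)
      = ((a + n + 1).choose (n + 1) : ℝ) * (n + 1) := by exact_mod_cast h
  push_cast
  linarith

lemma MC_ratio (k T : ℕ) (hk : 1 ≤ k) :
    ((T : ℝ) + k) / (MC (k + 1) T : ℝ) = (k : ℝ) / (MC k T : ℝ) := by
  rw [div_eq_div_iff (MC_pos_aux _ _ (by omega)).ne' (MC_pos_aux _ _ hk).ne']
  obtain ⟨a, rfl⟩ : ∃ a, k = a + 1 := ⟨k - 1, by omega⟩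
  unfold MC
  have e1 : a + 1 + 1 + T - 1 = a + T + 1 := by omega
  have e2 : a + 1 + T - 1 = a + T := by omega
  rw [e1, e2]
  have h := Nat.choose_mul_succ_eq (a + T) T
  have e3 : a + T + 1 - T = a + 1 := by omega
  rw [e3] at h
  have h' : ((a + T).choose T : ℝ) * ((a : ℝ) + T + 1)
      = ((a + T + 1).choose T : ℝ) * (a + 1) := by exact_mod_cast h
  push_cast
  linarith

lemma MC_zero_right (N : ℕ) : MC N 0 = 1 := by simp [MC]

lemma polya_base (N M : ℕ) (hN : 1 ≤ N) (n : ℕ) (hn : 1 ≤ n) :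
    (n : ℝ) * (MC N n : ℝ) / (MC n (N + M) : ℝ)
      + (M : ℝ) * ∑ i ∈ Finset.range n, (MC N i : ℝ) / (MC (i + 1) (N + M) : ℝ)
      = (N : ℝ) + M := by
  induction n, hn using Nat.le_induction with
  | base => simp [MC]
  | succ n hn ih =>
    rw [Finset.sum_range_succ, ← ih]
    have h1 := MC_step N n hN
    have h2 := MC_ratio n (N + M) hn
    push_cast at h2 ⊢
    rw [h1]
    linear_combination (MC N n : ℝ) * h2

lemma polya_step (N M m : ℕ) (hN : 1 ≤ N) (hM : 1 ≤ M) (hm : 1 ≤ m) (n : ℕ) :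
    (n : ℝ) * (MC N n : ℝ) * ((MC M m : ℝ) / (MC (n + m) (N + M) : ℝ))
      + ((m : ℝ) + 1) * (MC M (m + 1) : ℝ) *
        (∑ i ∈ Finset.range n, (MC N i : ℝ) / (MC (i + (m + 1)) (N + M) : ℝ))
      = (m : ℝ) * (MC M m : ℝ) *
        (∑ i ∈ Finset.range n, (MC N i : ℝ) / (MC (i + m) (N + M) : ℝ)) := by
  rw [MC_step M m hM]
  induction n with
  | zero => simp
  | succ n ih =>
    rw [Finset.sum_range_succ, Finset.sum_range_succ]
    have h1 := MC_step N n hN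
    have h2 := MC_ratio (n + m) (N + M) (by omega)
    have e : n + 1 + m = n + m + 1 := by omega
    rw [e, ← add_assoc n m 1]
    push_cast at h2 ⊢
    rw [h1]
    linear_combination ih + (MC N n : ℝ) * (MC M m : ℝ) * h2

/-- bivariate Pólya first-full probabilities add up to one. -/
theorem bivariate_polya_firstFull
    (n m N M : ℕ) (hn : 1 ≤ n) (hm : 1 ≤ m) (hN : 1 ≤ N) (hM : 1 ≤ M) :
    (n : ℝ) * (MC N n : ℝ) *
        (∑ j ∈ Finset.range m, (MC M j : ℝ) / (MC (n + j) (N + M) : ℝ)) +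
      (m : ℝ) * (MC M m : ℝ) *
        (∑ i ∈ Finset.range n, (MC N i : ℝ) / (MC (i + m) (N + M) : ℝ))
      = (N : ℝ) + (M : ℝ) := by
  induction m, hm using Nat.le_induction with
  | base =>
    have h := polya_base N M hN n hn
    have h1 : MC M 1 = M := by simp [MC]
    rw [← h, h1, Finset.sum_range_one, MC_zero_right]
    push_cast
    simp only [add_zero]
    ring
  | succ m hm ih =>
    rw [← ih, Finset.sum_range_succ]
    have h := polya_step N M m hN hM hm n
    push_cast
    linear_combination h
end

section
/- Let X be a finite set, let υ : X → ℕ be an urn of size L = ∑_{x∈X} υ(x) with L ≥ 1, and let φ : X → ℕ with φ(x) = 0 whenever υ(x) = 0 and K = ∑_{x∈X} φ(x). Then, as real numbers, (∏_{x∈X, υ(x)>0} MC(υ(x), φ(x))) / MC(L, K) = ∑_{(x₁,…,x_K)} ∏_{i=0}^{K−1} (υ(x_{i+1}) + aᵢ(x_{i+1})) / (L + i), where MC(a,b) = C(a+b−1, b), the sum ranges over all tuples (x₁,…,x_K) ∈ X^K whose accumulation equals φ, and aᵢ denotes the accumulation of the prefix (x₁,…,xᵢ) (with a₀ the empty multiset).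 -/
/-- The accumulation of a tuple: `acc v x` counts the indices `i` with `v i = x`. -/
def acc {X : Type*} [DecidableEq X] {K : ℕ} (v : Fin K → X) (x : X) : ℕ :=
  (Finset.univ.filter fun i => v i = x).card

/-- The accumulation of the length-`i` prefix of a tuple. -/
def prefAcc {X : Type*} [DecidableEq X] {K : ℕ} (v : Fin K → X) (i : ℕ) (x : X) : ℕ :=
  (Finset.univ.filter fun j : Fin K => (j : ℕ) < i ∧ v j = x).card

theorem mc_succ (n m : ℕ) :
    ((m : ℝ) + 1) * (n.multichoose (m + 1) : ℝ) = ((n : ℝ) + m) * (n.multichoose m : ℝ) := by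
  have h : (m + 1) * n.multichoose (m + 1) = (n + m) * n.multichoose m := by
    rw [Nat.multichoose_eq, Nat.multichoose_eq]
    rcases n with _ | n
    · rcases m with _ | m
      · simp
      · simp
    · have := Nat.add_one_mul_choose_eq (n + m) m
      have h2 := Nat.choose_succ_right_eq (n + m + 1) m
      have e1 : n + 1 + (m + 1) - 1 = n + m + 1 := by omega
      have e2 : n + 1 + m - 1 = n + m := by omega
      rw [e1, e2, mul_comm, ← this]
      ring
  exact_mod_cast h

theorem den_prod (L K : ℕ) :
    ∏ i : Fin K, ((L : ℝ) + ((i : ℕ) : ℝ)) = (K.factorial : ℝ) * (L.multichoose K : ℝ) := by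
  induction K with
  | zero => simp
  | succ K ih =>
    rw [Fin.prod_univ_castSucc]
    simp only [Fin.val_castSucc, Fin.val_last]
    rw [ih, Nat.factorial_succ]
    push_cast
    linear_combination (-(K.factorial : ℝ)) * mc_succ L K

theorem acc_snoc {X : Type*} [DecidableEq X] {K : ℕ} (v : Fin K → X) (a x : X) :
    acc (Fin.snoc v a : Fin (K + 1) → X) x = acc v x + if a = x then 1 else 0 := by
  simp only [acc, Finset.card_filter]
  rw [Fin.sum_univ_castSucc]
  simp

theorem prefAcc_snoc {X : Type*} [DecidableEq X] {K : ℕ} (v : Fin K → X) (a x : X) (i : ℕ)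
    (hi : i ≤ K) :
    prefAcc (Fin.snoc v a : Fin (K + 1) → X) i x = prefAcc v i x := by
  simp only [prefAcc, Finset.card_filter]
  rw [Fin.sum_univ_castSucc]
  simp [hi]

theorem prefAcc_full {X : Type*} [DecidableEq X] {K : ℕ} (v : Fin K → X) (x : X) :
    prefAcc v K x = acc v x := by
  simp [prefAcc, acc]

theorem num_sum {X : Type*} [Fintype X] [DecidableEq X] (υ : X → ℕ) (K : ℕ) :
    ∀ φ : X → ℕ, ∑ x, φ x = K →
    (∑ v : Fin K → X, if ∀ x, acc v x = φ x then
      ∏ i : Fin K, (((υ (v i) : ℕ) : ℝ) + ((prefAcc v i (v i) : ℕ) : ℝ)) else 0)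
      = (K.factorial : ℝ) * ∏ x, ((υ x).multichoose (φ x) : ℝ) := by
  induction K with
  | zero =>
    intro φ h
    have h0 : ∀ x, φ x = 0 := by simpa using h
    simp [acc, h0]
  | succ K ih =>
    intro φ h
    rw [← (Fin.snocEquiv (fun _ : Fin (K + 1) => X)).sum_comp, Fintype.sum_prod_type]
    have key : ∀ a : X, (∑ v : Fin K → X,
        if ∀ x, acc (Fin.snoc v a : Fin (K + 1) → X) x = φ x then
          ∏ i : Fin (K + 1), (((υ ((Fin.snoc v a : Fin (K + 1) → X) i) : ℕ) : ℝ) +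
            ((prefAcc (Fin.snoc v a : Fin (K + 1) → X) i
              ((Fin.snoc v a : Fin (K + 1) → X) i) : ℕ) : ℝ)) else 0)
        = (φ a : ℝ) * ((K.factorial : ℝ) * ∏ x, ((υ x).multichoose (φ x) : ℝ)) := by
      intro a
      rcases hm : φ a with _ | m
      · rw [Finset.sum_eq_zero]
        · simp
        · intro v _
          rw [if_neg]
          intro hc
          have := hc a
          rw [acc_snoc] at this
          simp [hm] at this
      · have hupd : ∑ x, Function.update φ a m x = K := by
          rw [Finset.sum_update_of_mem (Finset.mem_univ a)]
          rw [← Finset.add_sum_erase _ _ (Finset.mem_univ a), hm] at h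
          rw [Finset.sdiff_singleton_eq_erase]
          omega
        have hi := ih (Function.update φ a m) hupd
        have hprod : ((m : ℝ) + 1) * ∏ x, ((υ x).multichoose (φ x) : ℝ) =
            ((υ a : ℝ) + m) * ∏ x, ((υ x).multichoose (Function.update φ a m x) : ℝ) := by
          rw [← Finset.mul_prod_erase _ _ (Finset.mem_univ a),
            ← Finset.mul_prod_erase Finset.univ
              (fun x => ((υ x).multichoose (Function.update φ a m x) : ℝ)) (Finset.mem_univ a)]
          have : ∏ x ∈ Finset.univ.erase a, ((υ x).multichoose (Function.update φ a m x) : ℝ)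
              = ∏ x ∈ Finset.univ.erase a, ((υ x).multichoose (φ x) : ℝ) := by
            refine Finset.prod_congr rfl fun x hx => ?_
            rw [Function.update_of_ne (Finset.ne_of_mem_erase hx)]
          rw [this, hm, Function.update_self, ← mul_assoc, ← mul_assoc, mc_succ]
        trans ((υ a : ℝ) + m) * ((K.factorial : ℝ) *
          ∏ x, ((υ x).multichoose (Function.update φ a m x) : ℝ))
        · rw [← hi, Finset.mul_sum]
          refine Finset.sum_congr rfl fun v _ => ?_
          have hiff : (∀ x, acc (Fin.snoc v a : Fin (K + 1) → X) x = φ x) ↔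
              ∀ x, acc v x = Function.update φ a m x := by
            refine forall_congr' fun x => ?_
            rw [acc_snoc]
            by_cases hx : x = a
            · subst hx; simp [hm]
            · simp [hx, Ne.symm hx, eq_comm (a := a)]
          by_cases hc : ∀ x, acc v x = Function.update φ a m x
          · rw [if_pos (hiff.2 hc), if_pos hc, Fin.prod_univ_castSucc, mul_comm]
            congr 1
            · simp only [Fin.snoc_last, Fin.val_last]
              rw [prefAcc_snoc _ _ _ _ le_rfl, prefAcc_full, hc a, Function.update_self]
            · refine Finset.prod_congr rfl fun i _ => ?_
              simp only [Fin.snoc_castSucc, Fin.val_castSucc]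
              rw [prefAcc_snoc _ _ _ _ i.2.le]
          · rw [if_neg (fun h => hc (hiff.1 h)), if_neg hc, mul_zero]
        · push_cast
          linear_combination (-(K.factorial : ℝ)) * hprod
    refine (Finset.sum_congr rfl fun a _ => key a).trans ?_
    rw [← Finset.sum_mul, ← Nat.cast_sum, h, Nat.factorial_succ]
    push_cast
    ring

/-- the Pólya probability of a draw `φ` equals the sum, over all
tuples accumulating to `φ`, of the products of the successive Pólya draw
probabilities. -/
theorem polya_eq_sum_over_sequences
    (X : Type*) [Fintype X] [DecidableEq X]
    (υ φ : X → ℕ) (hL : 1 ≤ ∑ x, υ x) (hφ : ∀ x, υ x = 0 → φ x = 0)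
    (K : ℕ) (hK : ∑ x, φ x = K) :
    (∏ x ∈ Finset.univ.filter (fun x => 0 < υ x), (MC (υ x) (φ x) : ℝ)) /
        (MC (∑ x, υ x) K : ℝ)
      = ∑ v ∈ Finset.univ.filter (fun v : Fin K → X => ∀ x, acc v x = φ x),
          ∏ i : Fin K,
            (((υ (v i) : ℕ) : ℝ) + ((prefAcc v i (v i) : ℕ) : ℝ)) /
              ((((∑ x, υ x : ℕ)) : ℝ) + ((i : ℕ) : ℝ)) := by
  have hMC : ∀ a b, MC a b = a.multichoose b := fun a b => (Nat.multichoose_eq a b).symm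
  simp only [hMC, Finset.prod_div_distrib]
  rw [← Finset.sum_div, den_prod, Finset.sum_filter, num_sum υ K φ hK,
    mul_div_mul_left _ _ (by exact_mod_cast K.factorial_ne_zero)]
  congr 1
  refine Finset.prod_subset (Finset.filter_subset _ _) fun x _ hx => ?_
  have h0 : υ x = 0 := by simpa using hx
  simp [h0, hφ x h0]
end
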